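/- arXiv:2108.07192 — 3 statements merged into one kernel-verified Lean document; each statement's English description precedes it below -/
import Mathlib

section
/- For all natural numbers n and q, setting t = 18q + 3n + 54, the lower binomial tail satisfies ∑_{k=0}^{n} (t choose k) · 2^{−t} ≤ (1/12) · exp(−q). Equivalently, if X is a binomial random variable with t trials and success probability 1/2, then P(X ≤ n) ≤ (1/12)·exp(−q). -/
theorem tail_aux (n t : ℕ) (h : n + 1 ≤ t + 1) :
    ∑ k ∈ Finset.range (n + 1), (t.choose k : ℝ) ≤ 2 ^ n * (3 / 2 : ℝ) ^ t := by
  have h1 : (3 / 2 : ℝ) ^ t = ∑ k ∈ Finset.range (t + 1), (1 / 2 : ℝ) ^ k * (t.choose k : ℝ) := by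
    have := add_pow (1 / 2 : ℝ) 1 t
    norm_num at this ⊢
    exact this
  rw [h1, Finset.mul_sum]
  refine le_trans (Finset.sum_le_sum (g := fun k => 2 ^ n * ((1 / 2 : ℝ) ^ k * (t.choose k : ℝ))) ?_)
    (Finset.sum_le_sum_of_subset_of_nonneg (Finset.range_mono h) fun _ _ _ => by positivity)
  intro k hk
  have hk' : k ≤ n := by simpa [Nat.lt_succ_iff] using hk
  have h2 : (1 : ℝ) ≤ 2 ^ n * (1 / 2 : ℝ) ^ k := by
    obtain ⟨d, rfl⟩ := Nat.exists_eq_add_of_le hk'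
    have : (2 : ℝ) ^ (k + d) * (1 / 2 : ℝ) ^ k = 2 ^ d := by
      rw [pow_add, mul_right_comm, ← mul_pow]; norm_num
    rw [this]
    exact one_le_pow₀ (by norm_num)
  have h3 : (0 : ℝ) ≤ (t.choose k : ℝ) := by positivity
  nlinarith

theorem stmt3 (n q : ℕ) :
    ∑ k ∈ Finset.range (n + 1),
      (((18 * q + 3 * n + 54).choose k : ℝ) * (2 : ℝ) ^ (-((18 * q + 3 * n + 54 : ℕ) : ℤ))) ≤
      (1 / 12) * Real.exp (-(q : ℝ)) := by
  rw [← Finset.sum_mul]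
  have h := tail_aux n (18 * q + 3 * n + 54) (by omega)
  rw [zpow_neg, zpow_natCast]
  have he : ((3 / 4 : ℝ) ^ 18) ≤ Real.exp (-1) := by
    rw [Real.exp_neg]
    have := Real.exp_one_lt_d9
    have h3 : (3 : ℝ)⁻¹ ≤ (Real.exp 1)⁻¹ := inv_anti₀ (Real.exp_pos 1) (by linarith)
    refine le_trans ?_ h3
    norm_num
  have hq : ((3 / 4 : ℝ) ^ 18) ^ q ≤ Real.exp (-(q : ℝ)) := by
    have : Real.exp (-(q : ℝ)) = Real.exp (-1) ^ q := by
      rw [← Real.exp_nat_mul]; simp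
    rw [this]
    exact pow_le_pow_left₀ (by positivity) he q
  have hn : (27 / 32 : ℝ) ^ n ≤ 1 := pow_le_one₀ (by norm_num) (by norm_num)
  have hc : (3 / 4 : ℝ) ^ 54 ≤ 1 / 12 := by norm_num
  calc _ ≤ 2 ^ n * (3 / 2 : ℝ) ^ (18 * q + 3 * n + 54) * ((2 : ℝ) ^ (18 * q + 3 * n + 54))⁻¹ :=
        mul_le_mul_of_nonneg_right h (by positivity)
    _ = 2 ^ n * (3 / 4 : ℝ) ^ (18 * q + 3 * n + 54) := by
        rw [mul_assoc, ← inv_pow, ← mul_pow]; norm_num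
    _ = (27 / 32 : ℝ) ^ n * ((3 / 4 : ℝ) ^ 54 * ((3 / 4 : ℝ) ^ 18) ^ q) := by
        have : (27 / 32 : ℝ) = 2 * (3 / 4) ^ 3 := by norm_num
        rw [this, mul_pow, pow_add, pow_add, pow_mul, pow_mul]
        generalize (3 / 4 : ℝ) ^ 54 = c
        ring
    _ ≤ 1 * (1 / 12 * Real.exp (-(q : ℝ))) := by gcongr
    _ = _ := one_mul _
end

section
/- Let n be a natural number and let p₀, p₁, …, pₙ ∈ [0,1] with p₀ = 1, and let g₁, …, gₙ ∈ [0,1]. Then |√(pₙ) − ∏_{j=1}^{n} √(gⱼ)| ≤ ∑_{j=1}^{n} √(|pⱼ − p_{j−1}·gⱼ|), where √ denotes the real square root. -/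
theorem abs_sqrt_sub_sqrt_le_aux (a b : ℝ) (ha : 0 ≤ a) (hb : 0 ≤ b) :
    |Real.sqrt a - Real.sqrt b| ≤ Real.sqrt |a - b| := by
  apply Real.le_sqrt_of_sq_le
  have h1 := Real.sqrt_nonneg a
  have h2 := Real.sqrt_nonneg b
  have h : a - b = (Real.sqrt a - Real.sqrt b) * (Real.sqrt a + Real.sqrt b) := by
    nlinarith [Real.mul_self_sqrt ha, Real.mul_self_sqrt hb]
  rw [h, abs_mul, pow_two]
  apply mul_le_mul_of_nonneg_left _ (abs_nonneg _)
  rw [abs_of_nonneg (add_nonneg h1 h2), abs_le]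
  constructor <;> linarith

theorem stmt4 (n : ℕ) (p g : ℕ → ℝ)
    (hp : ∀ j ≤ n, p j ∈ Set.Icc (0 : ℝ) 1) (hp0 : p 0 = 1)
    (hg : ∀ j, 1 ≤ j → j ≤ n → g j ∈ Set.Icc (0 : ℝ) 1) :
    |Real.sqrt (p n) - ∏ j ∈ Finset.Icc 1 n, Real.sqrt (g j)| ≤
      ∑ j ∈ Finset.Icc 1 n, Real.sqrt |p j - p (j - 1) * g j| := by
  induction n with
  | zero => simp [hp0]
  | succ k ih =>
    have ih' := ih (fun j hj => hp j (by omega)) (fun j h1 h2 => hg j h1 (by omega))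
    rw [Finset.prod_Icc_succ_top (by omega), Finset.sum_Icc_succ_top (by omega)]
    rw [Nat.add_sub_cancel]
    have hg1 := hg (k + 1) (by omega) le_rfl
    have hp1 := hp (k + 1) le_rfl
    have hpk := hp k (by omega)
    have h1 := abs_sqrt_sub_sqrt_le_aux (p (k + 1)) (p k * g (k + 1)) hp1.1
      (mul_nonneg hpk.1 hg1.1)
    rw [Real.sqrt_mul hpk.1] at h1
    have hs : Real.sqrt (g (k + 1)) ≤ 1 := Real.sqrt_le_one.mpr hg1.2
    have hs0 := Real.sqrt_nonneg (g (k + 1))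
    generalize ∏ j ∈ Finset.Icc 1 k, Real.sqrt (g j) = P at *
    have h2 : |Real.sqrt (p k) * Real.sqrt (g (k + 1)) - P * Real.sqrt (g (k + 1))|
        ≤ |Real.sqrt (p k) - P| := by
      rw [← sub_mul, abs_mul, abs_of_nonneg hs0]
      exact mul_le_of_le_one_right (abs_nonneg _) hs
    have h3 := abs_sub_le (Real.sqrt (p (k + 1))) (Real.sqrt (p k) * Real.sqrt (g (k + 1)))
      (P * Real.sqrt (g (k + 1)))
    linarith
end

section
/- Let δ ≥ 0 and let a, b, ã, b̃ be real numbers with 0 ≤ a ≤ b ≤ 1, 0 ≤ ã ≤ 1, 0 ≤ b̃ ≤ 1, |ã − a| ≤ δ, and |b̃ − b| ≤ δ. Let μ = min(ã / b̃, 1), with the convention that x/0 = 0. Then |b·μ − a| ≤ 3δ. -/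
theorem stmt5 (δ a b ta tb : ℝ) (hδ : 0 ≤ δ)
    (ha0 : 0 ≤ a) (hab : a ≤ b) (hb1 : b ≤ 1)
    (hta0 : 0 ≤ ta) (hta1 : ta ≤ 1) (htb0 : 0 ≤ tb) (htb1 : tb ≤ 1)
    (haa : |ta - a| ≤ δ) (hbb : |tb - b| ≤ δ) :
    |b * min (ta / tb) 1 - a| ≤ 3 * δ := by
  rw [abs_le] at haa hbb ⊢
  obtain ⟨h1, h2⟩ := haa
  obtain ⟨h3, h4⟩ := hbb
  rcases htb0.eq_or_lt with h | h
  · subst h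
    simp only [div_zero, min_eq_left zero_le_one, mul_zero]
    constructor <;> linarith
  · rcases le_total ta tb with hle | hle
    · have hm1 : ta / tb ≤ 1 := (div_le_one h).2 hle
      have hm0 : 0 ≤ ta / tb := div_nonneg hta0 h.le
      have hm : ta / tb * tb = ta := div_mul_cancel₀ ta h.ne'
      rw [min_eq_left hm1]
      generalize ta / tb = m at *
      constructor <;> nlinarith
    · rw [min_eq_right ((one_le_div h).2 hle)]
      constructor <;> linarith
end
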